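/- Let G be a position and C a component of G. If C is a loop, then: if c(G−C) > 4 then v(G;C) = (size(C) − 8) + v(G−C) (i.e. keeping control is optimal for the controller), and if c(G−C) ≤ 4 then v(G;C) = size(C) − v(G−C) (i.e. giving up control is optimal). If C is a chain, then: if v(G−C) > 2 then v(G;C) = (size(C) − 4) + v(G−C), and if v(G−C) ≤ 2 then v(G;C) = size(C) − v(G−C). -/

import Mathlib

namespace DotsAndBoxes

/-- A component of a Dots & Boxes endgame position: an `n`-chain or an `n`-loop. -/
inductive Component : Type where
  | chain (n : ℕ)
  | loop (n : ℕ)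
deriving DecidableEq

namespace Component

/-- The number of boxes in a component. -/
def size : Component → ℕ
  | chain n => n
  | loop n => n

def isChain : Component → Bool
  | chain _ => true
  | loop _ => false

def isLoop : Component → Bool
  | chain _ => false
  | loop _ => true

/-- A chain must have length at least 3; a loop must have even length at least 4. -/
def Valid : Component → Prop
  | chain n => 3 ≤ n
  | loop n => 4 ≤ n ∧ Even n

end Component

/-- A position is a finite multiset of components. -/
abbrev Position := Multiset Component

def Position.Valid (G : Position) : Prop := ∀ C ∈ G, C.Valid

/-- The number of unclaimed boxes in a position. -/
def size (G : Position) : ℕ := (G.map Component.size).sum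

/-- The number of chains of a position. -/
def numChains (G : Position) : ℕ := Multiset.card (G.filter fun C => C.isChain = true)

/-- The number of loops of a position. -/
def numLoops (G : Position) : ℕ := Multiset.card (G.filter fun C => C.isLoop = true)

/-- θ(G), the number of 3-chains. -/
def theta (G : Position) : ℕ := G.count (Component.chain 3)

/-- f(G), the number of 4-loops. -/
def numF (G : Position) : ℕ := G.count (Component.loop 4)

/-- s(G), the number of 6-loops. -/
def numS (G : Position) : ℕ := G.count (Component.loop 6)

open Classical in
/-- The terminal bonus tb(G). -/
noncomputable def tb (G : Position) : ℤ :=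
  if G = 0 then 0
  else if ∀ C ∈ G, C.isLoop = true then 8
  else if (∃ C ∈ G, C.isLoop = true) ∧ Component.chain 3 ∈ G ∧
      (∀ C ∈ G, C.isChain = true → C = Component.chain 3) then 6
  else 4

/-- The controlled value c(G). -/
noncomputable def cval (G : Position) : ℤ :=
  (size G : ℤ) - 4 * (numChains G : ℤ) - 8 * (numLoops G : ℤ) + tb G

/-- The score v(G;C) of opening component `C`, given that the remainder of the
position has value `w`. -/
def openVal (C : Component) (w : ℤ) : ℤ :=
  match C with
  | Component.chain n => ((n : ℤ) - 2) + |w - 2|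
  | Component.loop n => ((n : ℤ) - 4) + |w - 4|

/-- Auxiliary recursion (on the number of components) for the value `v`. -/
noncomputable def valueAux : ℕ → Position → ℤ
  | 0, _ => 0
  | n + 1, G =>
    if G = 0 then 0
    else sInf { x : ℤ | ∃ C ∈ G, x = openVal C (valueAux n (G.erase C)) }

/-- The value v(G): v(∅) = 0, and v(G) = min over components C of G of v(G;C). -/
noncomputable def value (G : Position) : ℤ := valueAux (Multiset.card G) G

/-- v(G;C), the value of G given that the opener has just opened C. -/
noncomputable def valueOpen (G : Position) (C : Component) : ℤ :=
  openVal C (value (G.erase C))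

/-- Opening a component C of G is optimal if C ∈ G and v(G;C) = v(G). -/
def Optimal (G : Position) (C : Component) : Prop :=
  C ∈ G ∧ valueOpen G C = value G


/-- Contribution of a component to the controlled value. -/
def wt : Component → ℤ
  | Component.chain n => (n : ℤ) - 4
  | Component.loop n => (n : ℤ) - 8

/-- Controlled value without the terminal bonus. -/
def fc (G : Position) : ℤ := (G.map wt).sum

lemma fc_cons (C : Component) (H : Position) : fc (C ::ₘ H) = wt C + fc H := by
  simp [fc]

lemma cval_eq (G : Position) : cval G = fc G + tb G := by
  have h : (size G : ℤ) - 4 * (numChains G : ℤ) - 8 * (numLoops G : ℤ) = fc G := by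
    induction G using Multiset.induction_on with
    | empty => simp [size, numChains, numLoops, fc]
    | cons C H ih =>
      rw [fc_cons, ← ih]
      have hs : size (C ::ₘ H) = C.size + size H := by simp [size]
      have h1 : numChains (C ::ₘ H) = (if C.isChain = true then 1 else 0) + numChains H := by
        unfold numChains
        by_cases h : C.isChain = true
        · rw [Multiset.filter_cons_of_pos (p := fun C : Component => C.isChain = true) _ h, if_pos h, Multiset.card_cons, add_comm]
        · rw [Multiset.filter_cons_of_neg (p := fun C : Component => C.isChain = true) _ h, if_neg h, zero_add]
      have h2 : numLoops (C ::ₘ H) = (if C.isLoop = true then 1 else 0) + numLoops H := by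
        unfold numLoops
        by_cases h : C.isLoop = true
        · rw [Multiset.filter_cons_of_pos (p := fun C : Component => C.isLoop = true) _ h, if_pos h, Multiset.card_cons, add_comm]
        · rw [Multiset.filter_cons_of_neg (p := fun C : Component => C.isLoop = true) _ h, if_neg h, zero_add]
      rw [hs, h1, h2]
      cases C <;> simp [Component.isChain, Component.isLoop, Component.size, wt] <;> ring
  unfold cval
  rw [h]

lemma value_zero : value 0 = 0 := by simp [value, valueAux]

lemma value_spec (G : Position) (hG : G ≠ 0) :
    (∃ C ∈ G, value G = openVal C (value (G.erase C))) ∧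
    ∀ C ∈ G, value G ≤ openVal C (value (G.erase C)) := by
  obtain ⟨n, hn⟩ : ∃ n, Multiset.card G = n + 1 :=
    Nat.exists_eq_succ_of_ne_zero (by simpa using hG)
  have hv : value G = sInf { x : ℤ | ∃ C ∈ G, x = openVal C (valueAux n (G.erase C)) } := by
    unfold value
    rw [hn]
    simp [valueAux, hG]
  have he : ∀ C ∈ G, value (G.erase C) = valueAux n (G.erase C) := by
    intro C hC
    unfold value
    rw [Multiset.card_erase_of_mem hC, hn]
    rfl
  set S := { x : ℤ | ∃ C ∈ G, x = openVal C (valueAux n (G.erase C)) } with hS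
  have hfin : S.Finite := by
    have : S = Set.image (fun C => openVal C (valueAux n (G.erase C)))
        (G.toFinset : Set Component) := by
      ext x
      simp [hS, eq_comm]
    rw [this]
    exact (Finset.finite_toSet _).image _
  have hne : S.Nonempty := by
    obtain ⟨C, hC⟩ := Multiset.exists_mem_of_ne_zero hG
    exact ⟨_, C, hC, rfl⟩
  constructor
  · obtain ⟨C, hC, h⟩ := Int.csInf_mem hne hfin.bddBelow
    exact ⟨C, hC, by rw [hv, he C hC]; exact h⟩
  · intro C hC
    rw [hv, he C hC]
    exact csInf_le hfin.bddBelow ⟨C, hC, rfl⟩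

lemma value_cons_le (C : Component) (H : Position) :
    value (C ::ₘ H) ≤ openVal C (value H) := by
  have := (value_spec (C ::ₘ H) (by simp)).2 C (by simp)
  simpa using this

lemma value_cons_exists (G : Position) (hG : G ≠ 0) :
    ∃ C H, G = C ::ₘ H ∧ value G = openVal C (value H) := by
  obtain ⟨C, hC, h⟩ := (value_spec G hG).1
  exact ⟨C, G.erase C, (Multiset.cons_erase hC).symm, h⟩

lemma value_nonneg (G : Position) (hG : G.Valid) : 0 ≤ value G := by
  by_cases h0 : G = 0
  · rw [h0, value_zero]
  obtain ⟨C, H, rfl, h⟩ := value_cons_exists G h0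
  have hv := hG C (by simp)
  rw [h]
  cases C with
  | chain n =>
    simp only [Component.Valid] at hv
    simp only [openVal]
    have := abs_nonneg (value H - 2)
    omega
  | loop n =>
    simp only [Component.Valid] at hv
    simp only [openVal]
    have := abs_nonneg (value H - 4)
    omega

lemma value_ge_two (G : Position) (h0 : G ≠ 0)
    (hc : ∀ n, Component.chain n ∈ G → 4 ≤ n) (hl : ∀ n, Component.loop n ∈ G → 6 ≤ n) :
    2 ≤ value G := by
  obtain ⟨C, H, rfl, h⟩ := value_cons_exists G h0
  rw [h]
  cases C with
  | chain n =>
    have := hc n (by simp)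
    simp only [openVal]
    have := abs_nonneg (value H - 2)
    omega
  | loop n =>
    have := hl n (by simp)
    simp only [openVal]
    have := abs_nonneg (value H - 4)
    omega

lemma tb_zero : tb 0 = 0 := by simp [tb]

lemma tb_loops (G : Position) (h0 : G ≠ 0) (h : ∀ n, Component.chain n ∉ G) : tb G = 8 := by
  have : ∀ C ∈ G, C.isLoop = true := by
    rintro (n | n) hC
    · exact absurd hC (h n)
    · rfl
  unfold tb
  rw [if_neg h0, if_pos this]

lemma tb_chains (G : Position) (h0 : G ≠ 0) (h : ∀ n, Component.loop n ∉ G) : tb G = 4 := by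
  have h1 : ∀ C ∈ G, C.isLoop = false := by
    rintro (n | n) hC
    · rfl
    · exact absurd hC (h n)
  have h2 : ¬ ∀ C ∈ G, C.isLoop = true := by
    intro h3
    obtain ⟨C, hC⟩ := Multiset.exists_mem_of_ne_zero h0
    have a := h1 C hC
    have b := h3 C hC
    simp [a] at b
  unfold tb
  rw [if_neg h0, if_neg h2, if_neg]
  rintro ⟨⟨C, hC, hC'⟩, -⟩
  have a := h1 C hC
  simp [a] at hC'

lemma tb_long (G : Position) (n : ℕ) (h : Component.chain n ∈ G) (hn : n ≠ 3) : tb G = 4 := by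
  have h0 : G ≠ 0 := by rintro rfl; simp at h
  have h2 : ¬ ∀ C ∈ G, C.isLoop = true := by
    intro h3
    have := h3 _ h
    simp [Component.isLoop] at this
  unfold tb
  rw [if_neg h0, if_neg h2, if_neg]
  rintro ⟨-, -, h3⟩
  have := h3 _ h rfl
  simp at this
  exact hn this

lemma tb_six (G : Position) (m : ℕ) (h : Component.chain 3 ∈ G) (hl : Component.loop m ∈ G)
    (hc : ∀ n, Component.chain n ∈ G → n = 3) : tb G = 6 := by
  have h0 : G ≠ 0 := by rintro rfl; simp at h
  have h2 : ¬ ∀ C ∈ G, C.isLoop = true := by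
    intro h3
    have := h3 _ h
    simp [Component.isLoop] at this
  unfold tb
  rw [if_neg h0, if_neg h2, if_pos]
  refine ⟨⟨_, hl, rfl⟩, h, ?_⟩
  rintro (n | n) hC hC'
  · rw [hc n hC]
  · simp [Component.isChain] at hC'

/-- Summary of the possible values of the terminal bonus. -/
lemma tb_cases (G : Position) (h0 : G ≠ 0) :
    (tb G = 8 ∧ ∀ n, Component.chain n ∉ G) ∨
    (tb G = 4 ∧ ∀ n, Component.loop n ∉ G) ∨
    (tb G = 4 ∧ ∃ n, n ≠ 3 ∧ Component.chain n ∈ G) ∨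
    (tb G = 6 ∧ Component.chain 3 ∈ G ∧ (∃ m, Component.loop m ∈ G) ∧
      ∀ n, Component.chain n ∈ G → n = 3) := by
  by_cases h1 : ∀ n, Component.chain n ∉ G
  · exact Or.inl ⟨tb_loops G h0 h1, h1⟩
  by_cases h2 : ∀ n, Component.loop n ∉ G
  · exact Or.inr (Or.inl ⟨tb_chains G h0 h2, h2⟩)
  by_cases h3 : ∃ n, n ≠ 3 ∧ Component.chain n ∈ G
  · obtain ⟨n, hn, h⟩ := h3
    exact Or.inr (Or.inr (Or.inl ⟨tb_long G n h hn, n, hn, h⟩))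
  · push Not at h1 h2 h3
    obtain ⟨n, hn⟩ := h1
    obtain ⟨m, hm⟩ := h2
    have hc : ∀ n, Component.chain n ∈ G → n = 3 := by
      intro k hk
      by_contra hk'
      exact h3 k hk' hk
    have h3' : Component.chain 3 ∈ G := by
      have := hc n hn
      rwa [this] at hn
    exact Or.inr (Or.inr (Or.inr ⟨tb_six G m h3' hm hc, h3', ⟨m, hm⟩, hc⟩))

lemma tb_bounds (G : Position) (h0 : G ≠ 0) : 4 ≤ tb G ∧ tb G ≤ 8 := by
  rcases tb_cases G h0 with h | h | h | h <;> omega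

/-- Removing a chain does not decrease the terminal bonus. -/
lemma tb_cons_chain (n : ℕ) (H : Position) (h0 : H ≠ 0) :
    tb (Component.chain n ::ₘ H) ≤ tb H := by
  have hb := tb_bounds H h0
  rcases tb_cases (Component.chain n ::ₘ H) (by simp) with h | h | h | h
  · exact absurd (Multiset.mem_cons_self _ _) (h.2 n)
  · omega
  · omega
  · obtain ⟨h6, -, ⟨m, hm⟩, hc⟩ := h
    have hm' : Component.loop m ∈ H := by simpa using hm
    rcases tb_cases H h0 with h | h | h | h
    · omega
    · exact absurd hm' (h.2 m)
    · obtain ⟨-, k, hk, hk'⟩ := h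
      exact absurd (hc k (Multiset.mem_cons_of_mem hk')) hk
    · omega

/-- Removing a loop changes nothing, unless only 3-chains remain. -/
lemma tb_cons_loop (n : ℕ) (H : Position) (h0 : H ≠ 0)
    (h3 : Component.chain 3 ∈ H → (∃ m, Component.loop m ∈ H) ∨
      ∃ m, m ≠ 3 ∧ Component.chain m ∈ H) :
    tb (Component.loop n ::ₘ H) = tb H := by
  rcases tb_cases H h0 with h | h | h | h
  · rw [h.1]
    exact tb_loops _ (by simp) (by simpa using h.2)
  · obtain ⟨C, hC⟩ := Multiset.exists_mem_of_ne_zero h0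
    rcases C with k | k
    · by_cases hk : k = 3
      · subst hk
        rcases h3 hC with ⟨m, hm⟩ | ⟨m, hm, hm'⟩
        · exact absurd hm (h.2 m)
        · rw [h.1]
          exact tb_long _ m (Multiset.mem_cons_of_mem hm') hm
      · rw [h.1]
        exact tb_long _ k (Multiset.mem_cons_of_mem hC) hk
    · exact absurd hC (h.2 k)
  · obtain ⟨h, k, hk, hk'⟩ := h
    rw [h]
    exact tb_long _ k (Multiset.mem_cons_of_mem hk') hk
  · obtain ⟨h, hc3, -, hc⟩ := h
    rw [h]
    exact tb_six _ n (Multiset.mem_cons_of_mem hc3) (by simp) (by simpa using hc)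

lemma fc_nonneg (G : Position) (hc : ∀ n, Component.chain n ∈ G → 4 ≤ n)
    (hl : ∀ n, Component.loop n ∈ G → 8 ≤ n) : 0 ≤ fc G := by
  unfold fc
  apply Multiset.sum_nonneg
  intro x hx
  obtain ⟨C, hC, rfl⟩ := Multiset.mem_map.1 hx
  rcases C with n | n
  · have := hc n hC
    simp only [wt]
    omega
  · have := hl n hC
    simp only [wt]
    omega

lemma fc_threes (G : Position) (h : ∀ C ∈ G, C = Component.chain 3) :
    fc G = - (Multiset.card G : ℤ) := by
  have : G = Multiset.replicate (Multiset.card G) (Component.chain 3) :=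
    Multiset.eq_replicate_card.2 h
  rw [this]
  simp [fc, wt]

lemma openVal_zero (C : Component) : openVal C 0 = C.size := by
  cases C <;> simp [openVal, Component.size]

lemma value_single (C : Component) : value {C} = C.size := by
  obtain ⟨D, H, h, h'⟩ := value_cons_exists {C} (by simp)
  have hcd := congrArg Multiset.card h
  have hH : H = 0 := by
    rw [← Multiset.card_eq_zero]
    simpa using hcd.symm
  subst hH
  have hD : D = C := by
    have : D ∈ ({C} : Position) := by rw [h]; simp
    simpa using this
  subst hD
  rw [h', value_zero, openVal_zero]

lemma cval_single (C : Component) : cval {C} = C.size := by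
  rw [cval_eq]
  cases C with
  | chain n =>
    rw [tb_chains _ (by simp) (by simp)]
    simp [fc, wt, Component.size]
  | loop n =>
    rw [tb_loops _ (by simp) (by simp)]
    simp [fc, wt, Component.size]

/-- The controlled value is a lower bound for the value. -/
lemma cval_le_value (N : ℕ) : ∀ G : Position, Multiset.card G = N → cval G ≤ value G := by
  induction N with
  | zero =>
    intro G hG
    rw [Multiset.card_eq_zero] at hG
    rw [hG, value_zero, cval_eq, tb_zero]
    simp [fc]
  | succ N ih =>
    intro G hG
    have h0 : G ≠ 0 := by rintro rfl; simp at hG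
    obtain ⟨C, H, rfl, h⟩ := value_cons_exists G h0
    have hi := ih H (by simpa using hG)
    by_cases hH : H = 0
    · subst hH
      have e : C ::ₘ (0 : Position) = {C} := rfl
      rw [e, cval_single, value_single]
    rw [h]
    rw [cval_eq] at hi ⊢
    rw [fc_cons]
    rcases C with n | n
    · have := tb_cons_chain n H hH
      have := le_abs_self (value H - 2)
      simp only [openVal, wt]
      omega
    · have ha := le_abs_self (value H - 4)
      simp only [openVal, wt]
      by_cases h3 : Component.chain 3 ∈ H → (∃ m, Component.loop m ∈ H) ∨
          ∃ m, m ≠ 3 ∧ Component.chain m ∈ H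
      · have := tb_cons_loop n H hH h3
        omega
      · push Not at h3
        obtain ⟨hm, hl, hc⟩ := h3
        have hc' : ∀ k, Component.chain k ∈ H → k = 3 := by
          intro k hk
          by_contra hk'
          exact hc k hk' hk
        have hall : ∀ C ∈ H, C = Component.chain 3 := by
          rintro (k | k) hk
          · rw [hc' k hk]
          · exact absurd hk (hl k)
        rw [fc_threes H hall, tb_six _ n (Multiset.mem_cons_of_mem hm) (by simp)
          (by simpa using hc')]
        by_cases hcard : Multiset.card H = 1
        · have e : H = {Component.chain 3} := by
            rw [Multiset.eq_replicate_card.2 hall, hcard]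
            rfl
          have hv : value H = 3 := by
            rw [e, value_single]
            rfl
          rw [hcard, hv]
          norm_num
          omega
        · have : Multiset.card H ≠ 0 := by simpa using hH
          have := abs_nonneg (value H - 4)
          omega

lemma valid_of_cons {C : Component} {H : Position} (h : Position.Valid (C ::ₘ H)) :
    Position.Valid H :=
  fun D hD => h D (Multiset.mem_cons_of_mem hD)

lemma value_le_max (N : ℕ) : ∀ G : Position, G.Valid → Multiset.card G = N →
    value G ≤ max 4 (cval G) := by
  induction N with
  | zero =>
    intro G _ hG
    rw [Multiset.card_eq_zero] at hG
    rw [hG, value_zero]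
    simp
  | succ N ih =>
    intro G hV hG
    -- data for any decomposition of G
    have key : ∀ (C : Component) (H : Position), G = C ::ₘ H → value G ≤ openVal C (value H) ∧ 0 ≤ value H ∧
        value H ≤ max 4 (cval H) ∧ cval H ≤ value H ∧ Position.Valid H ∧ Component.Valid C := by
      rintro C H rfl
      have hH := valid_of_cons hV
      exact ⟨value_cons_le C H, value_nonneg H hH, ih H hH (by simpa using hG),
        cval_le_value _ H rfl, hH, hV C (by simp)⟩
    by_cases hcard : N = 0
    · subst hcard
      obtain ⟨C, rfl⟩ := Multiset.card_eq_one.1 hG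
      rw [value_single, cval_single]
      exact le_max_right _ _
    have hne : ∀ C H, G = C ::ₘ H → H ≠ 0 := by
      rintro C H rfl rfl
      simp at hG
      omega
    by_cases h3 : Component.chain 3 ∈ G
    · obtain ⟨H, hGH⟩ := Multiset.exists_cons_of_mem h3
      obtain ⟨k1, k2, k3, k4, k5, k6⟩ := key _ _ hGH
      have hH := hne _ _ hGH
      simp only [openVal] at k1
      by_cases hch : ∃ n, Component.chain n ∈ H
      · -- the bonus is unchanged
        have ht : tb H = tb G := by
          apply le_antisymm _ (by rw [hGH]; exact tb_cons_chain 3 H hH)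
          have hb := tb_bounds G (by rw [hGH]; simp)
          rcases tb_cases H hH with h | h | h | h
          · obtain ⟨n, hn⟩ := hch
            exact absurd hn (h.2 n)
          · omega
          · omega
          · obtain ⟨h6, _, ⟨m, hm⟩, hc⟩ := h
            rw [h6, hGH, tb_six _ m (by simp) (Multiset.mem_cons_of_mem hm)]
            simpa using hc
        have hc : cval H = cval G + 1 := by
          rw [cval_eq, cval_eq, ht, hGH, fc_cons]
          simp only [wt]
          push_cast
          ring
        rw [hc] at k3
        rcases abs_cases (value H - 2) with ⟨ha, _⟩ | ⟨ha, _⟩ <;> rw [ha] at k1 <;>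
          push_cast at k1 <;> omega
      · push Not at hch
        have htH : tb H = 8 := tb_loops H hH hch
        have hcH : cval H = fc H + 8 := by rw [cval_eq, htH]
        have hlG : ∃ m, Component.loop m ∈ H := by
          obtain ⟨C, hC⟩ := Multiset.exists_mem_of_ne_zero hH
          rcases C with m | m
          · exact absurd hC (hch m)
          · exact ⟨m, hC⟩
        have htG : tb G = 6 := by
          obtain ⟨m, hm⟩ := hlG
          rw [hGH]
          apply tb_six _ m (by simp) (Multiset.mem_cons_of_mem hm)
          intro n hn
          simpa [hch n] using hn
        have hcG : cval G = fc H + 5 := by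
          rw [cval_eq, htG, hGH, fc_cons]
          simp only [wt]
          push_cast
          ring
        -- data for opening a loop
        have lkey : ∀ n K, H = Component.loop n ::ₘ K → K ≠ 0 →
            ∃ x, value G ≤ (n : ℤ) - 4 + |x - 4| ∧ 0 ≤ x ∧
              x ≤ max 4 (cval G + 8 - n) ∧ cval G + 8 - n ≤ x := by
          intro n K hK hK0
          have e : G = Component.loop n ::ₘ (Component.chain 3 ::ₘ K) := by
            rw [hGH, hK, Multiset.cons_swap]
          obtain ⟨l1, l2, l3, l4, -, -⟩ := key _ _ e
          have ht : tb (Component.chain 3 ::ₘ K) = 6 := by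
            obtain ⟨C, hC⟩ := Multiset.exists_mem_of_ne_zero hK0
            have hK' : ∀ k, Component.chain k ∉ K := by
              intro k hk
              exact hch k (by rw [hK]; exact Multiset.mem_cons_of_mem hk)
            rcases C with m | m
            · exact absurd hC (hK' m)
            · apply tb_six _ m (by simp) (Multiset.mem_cons_of_mem hC)
              intro k hk
              simpa [hK' k] using hk
          have hc : cval (Component.chain 3 ::ₘ K) = cval G + 8 - n := by
            rw [hcG, cval_eq, ht, hK, fc_cons, fc_cons]
            simp only [wt]
            push_cast
            ring
          rw [hc] at l3 l4
          exact ⟨_, l1, l2, l3, l4⟩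
        -- a single loop
        have lone : ∀ n, H = Component.loop n ::ₘ 0 → value G ≤ max 4 (cval G) := by
          intro n hK
          have e : G = Component.loop n ::ₘ {Component.chain 3} := by
            rw [hGH, hK, Multiset.cons_swap]
            rfl
          have l1 := (key _ _ e).1
          rw [value_single] at l1
          have : cval G = n - 3 := by
            rw [hcG, hK, fc_cons]
            simp [fc, wt]
            ring
          simp [openVal, Component.size] at l1
          omega
        by_cases hl4 : Component.loop 4 ∈ H
        · obtain ⟨K, hK⟩ := Multiset.exists_cons_of_mem hl4
          by_cases hK0 : K = 0
          · exact lone 4 (by rw [hK, hK0])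
          obtain ⟨x, x1, x2, x3, x4⟩ := lkey _ _ hK hK0
          rcases abs_cases (x - 4) with ⟨ha, _⟩ | ⟨ha, _⟩ <;> rw [ha] at x1 <;>
            push_cast at * <;> omega
        by_cases hl6 : Component.loop 6 ∈ H
        · obtain ⟨K, hK⟩ := Multiset.exists_cons_of_mem hl6
          by_cases hK0 : K = 0
          · exact lone 6 (by rw [hK, hK0])
          obtain ⟨x, x1, x2, x3, x4⟩ := lkey _ _ hK hK0
          rcases abs_cases (x - 4) with ⟨ha, _⟩ | ⟨ha, _⟩ <;> rw [ha] at x1 <;>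
            rcases abs_cases (value H - 2) with ⟨hb, _⟩ | ⟨hb, _⟩ <;> rw [hb] at k1 <;>
            push_cast at * <;> omega
        · have hl8 : ∀ n, Component.loop n ∈ H → 8 ≤ n := by
            intro n hn
            obtain ⟨a, b, rfl⟩ := k5 _ hn
            by_contra hlt
            have : b = 2 ∨ b = 3 := by omega
            rcases this with rfl | rfl
            · exact hl4 hn
            · exact hl6 hn
          obtain ⟨m, hm⟩ := hlG
          obtain ⟨K, hK⟩ := Multiset.exists_cons_of_mem hm
          by_cases hK0 : K = 0
          · exact lone m (by rw [hK, hK0])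
          have hf : 0 ≤ fc K := by
            apply fc_nonneg
            · intro n hn
              exact absurd (by rw [hK]; exact Multiset.mem_cons_of_mem hn) (hch n)
            · intro n hn
              exact hl8 n (by rw [hK]; exact Multiset.mem_cons_of_mem hn)
          have hf' : fc H = m - 8 + fc K := by rw [hK, fc_cons]; rfl
          obtain ⟨x, x1, x2, x3, x4⟩ := lkey _ _ hK hK0
          rcases abs_cases (x - 4) with ⟨ha, _⟩ | ⟨ha, _⟩ <;> rw [ha] at x1 <;> omega
    · -- no 3-chains
      have hc4 : ∀ n, Component.chain n ∈ G → 4 ≤ n := by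
        intro n hn
        have h : 3 ≤ n := hV _ hn
        rcases Nat.eq_or_lt_of_le h with h' | h'
        · subst h'
          exact absurd hn h3
        · exact h'
      have loopc : ∀ n H, G = Component.loop n ::ₘ H → cval H = cval G + 8 - n := by
        intro n H e
        have ht := tb_cons_loop n H (hne _ _ e) (by
          intro h
          exact absurd (by rw [e]; exact Multiset.mem_cons_of_mem h) h3)
        rw [cval_eq, cval_eq, e, ht, fc_cons]
        simp only [wt]
        ring
      by_cases hl4 : Component.loop 4 ∈ G
      · obtain ⟨H, hGH⟩ := Multiset.exists_cons_of_mem hl4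
        obtain ⟨k1, k2, k3, k4, k5, k6⟩ := key _ _ hGH
        rw [loopc _ _ hGH] at k3
        simp only [openVal] at k1
        rcases abs_cases (value H - 4) with ⟨ha, _⟩ | ⟨ha, _⟩ <;> rw [ha] at k1 <;>
          push_cast at * <;> omega
      have hl6' : ∀ n, Component.loop n ∈ G → 6 ≤ n := by
        intro n hn
        obtain ⟨a, b, rfl⟩ := hV _ hn
        by_contra hlt
        have : b = 2 := by omega
        subst this
        exact hl4 hn
      by_cases hl6 : Component.loop 6 ∈ G
      · obtain ⟨H, hGH⟩ := Multiset.exists_cons_of_mem hl6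
        obtain ⟨k1, k2, k3, k4, k5, k6⟩ := key _ _ hGH
        rw [loopc _ _ hGH] at k3
        simp only [openVal] at k1
        have h2 : 2 ≤ value H := by
          apply value_ge_two H (hne _ _ hGH)
          · intro n hn
            exact hc4 n (by rw [hGH]; exact Multiset.mem_cons_of_mem hn)
          · intro n hn
            exact hl6' n (by rw [hGH]; exact Multiset.mem_cons_of_mem hn)
        rcases abs_cases (value H - 4) with ⟨ha, _⟩ | ⟨ha, _⟩ <;> rw [ha] at k1 <;>
          push_cast at * <;> omega
      have hl8 : ∀ n, Component.loop n ∈ G → 8 ≤ n := by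
        intro n hn
        have h6 := hl6' n hn
        obtain ⟨a, b, rfl⟩ := hV _ hn
        by_contra hlt
        have : b = 3 := by omega
        subst this
        exact hl6 hn
      have sub4 : ∀ C H, G = C ::ₘ H → 4 ≤ cval H := by
        intro C H e
        have hf : 0 ≤ fc H := by
          apply fc_nonneg
          · intro n hn
            exact hc4 n (by rw [e]; exact Multiset.mem_cons_of_mem hn)
          · intro n hn
            exact hl8 n (by rw [e]; exact Multiset.mem_cons_of_mem hn)
        have := tb_bounds H (hne _ _ e)
        rw [cval_eq]
        omega
      by_cases hl : ∃ n, Component.loop n ∈ G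
      · obtain ⟨n, hn⟩ := hl
        obtain ⟨H, hGH⟩ := Multiset.exists_cons_of_mem hn
        obtain ⟨k1, k2, k3, k4, k5, k6⟩ := key _ _ hGH
        have hs := sub4 _ _ hGH
        rw [loopc _ _ hGH] at k3 k4 hs
        simp only [openVal] at k1
        rcases abs_cases (value H - 4) with ⟨ha, _⟩ | ⟨ha, _⟩ <;> rw [ha] at k1 <;> omega
      · push Not at hl
        have hG0 : G ≠ 0 := by rintro rfl; simp at hG
        obtain ⟨C, hC⟩ := Multiset.exists_mem_of_ne_zero hG0
        rcases C with n | n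
        swap
        · exact absurd hC (hl n)
        obtain ⟨H, hGH⟩ := Multiset.exists_cons_of_mem hC
        obtain ⟨k1, k2, k3, k4, k5, k6⟩ := key _ _ hGH
        have hs := sub4 _ _ hGH
        have hcv : cval H = cval G + 4 - n := by
          have t1 := tb_chains G hG0 hl
          have t2 := tb_chains H (hne _ _ hGH) (fun m hm =>
            hl m (by rw [hGH]; exact Multiset.mem_cons_of_mem hm))
          rw [cval_eq, cval_eq, t1, t2, hGH, fc_cons]
          simp only [wt]
          ring
        rw [hcv] at k3 k4 hs
        simp only [openVal] at k1
        rcases abs_cases (value H - 2) with ⟨ha, _⟩ | ⟨ha, _⟩ <;> rw [ha] at k1 <;> omega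

/-- Controller strategy: if C is a loop, keeping control is optimal when
c(G−C) > 4 and giving up control is optimal when c(G−C) ≤ 4; if C is a chain,
keeping control is optimal when v(G−C) > 2 and giving up control is optimal
when v(G−C) ≤ 2. -/
theorem controller_strategy (G : Position) (hG : G.Valid) (C : Component) (hC : C ∈ G) :
    (C.isLoop = true →
      (4 < cval (G.erase C) →
        valueOpen G C = ((C.size : ℤ) - 8) + value (G.erase C)) ∧
      (cval (G.erase C) ≤ 4 →
        valueOpen G C = (C.size : ℤ) - value (G.erase C))) ∧
    (C.isChain = true →
      (2 < value (G.erase C) →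
        valueOpen G C = ((C.size : ℤ) - 4) + value (G.erase C)) ∧
      (value (G.erase C) ≤ 2 →
        valueOpen G C = (C.size : ℤ) - value (G.erase C))) := by
  have hV : Position.Valid (G.erase C) := fun D hD => hG D (Multiset.mem_of_mem_erase hD)
  have hlo := cval_le_value _ (G.erase C) rfl
  have hhi := value_le_max _ (G.erase C) hV rfl
  unfold valueOpen
  generalize value (G.erase C) = x at *
  generalize cval (G.erase C) = c at *
  cases C with
  | chain n =>
    simp only [Component.isLoop, Component.size, openVal]
    refine ⟨by simp, fun _ => ⟨fun h => ?_, fun h => ?_⟩⟩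
    · rw [abs_of_nonneg (by omega)]; ring
    · rw [abs_of_nonpos (by omega)]; ring
  | loop n =>
    simp only [Component.isChain, Component.size, openVal]
    refine ⟨fun _ => ⟨fun h => ?_, fun h => ?_⟩, by simp⟩
    · rw [abs_of_nonneg (by omega)]; ring
    · rw [abs_of_nonpos (by omega)]; ring

end DotsAndBoxes
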